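/- Let x ~ N(0, I_L), let ã = Ua and x̃ = Ux for a unitary U with Uw = (0,...,0,‖w‖)^T. Then for i ≠ L, the i-th coordinate of the rotated gradient of the ReLU loss satisfies [U ∂L/∂w]_i = ã_i · Φ(b/‖w‖), where L(θ) = E[(1/2)·1_{w^T x + b > 0}·(a^T x + c)²]. -/

import Mathlib

open MeasureTheory ProbabilityTheory Matrix

/-- The standard multivariate Gaussian `N(0, I_L)` on `ℝ^L`. -/
noncomputable def stdGaussian (L : ℕ) : Measure (Fin L → ℝ) :=
  Measure.pi fun _ => gaussianReal 0 1

/-- Euclidean norm of a vector in `ℝ^L`. -/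
noncomputable def l2norm {L : ℕ} (v : Fin L → ℝ) : ℝ :=
  Real.sqrt (∑ i, (v i) ^ 2)

/-- The standard normal pdf `φ`. -/
noncomputable def phiPdf (t : ℝ) : ℝ :=
  Real.exp (-t ^ 2 / 2) / Real.sqrt (2 * Real.pi)

/-- The standard normal CDF `Φ`. -/
noncomputable def Phi (t : ℝ) : ℝ :=
  ∫ s in Set.Iic t, phiPdf s

section GaussianPi

variable {ι : Type*} [Fintype ι]

theorem dotProduct_mulVec_of_transpose_mul_self [DecidableEq ι] {U : Matrix ι ι ℝ}
    (hU : Uᵀ * U = 1) (u v : ι → ℝ) : U.mulVec u ⬝ᵥ U.mulVec v = u ⬝ᵥ v := by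
  rw [Matrix.dotProduct_mulVec, Matrix.vecMul_mulVec, hU, Matrix.vecMul_one]

theorem measurePreserving_mulVec_pi_gaussianReal [DecidableEq ι] {U : Matrix ι ι ℝ}
    (hU : Uᵀ * U = 1) :
    MeasurePreserving U.mulVec (Measure.pi fun _ : ι => gaussianReal 0 1)
      (Measure.pi fun _ : ι => gaussianReal 0 1) := by
  have hmeas : Measurable U.mulVec :=
    (Continuous.matrix_mulVec continuous_const continuous_id).measurable
  refine ⟨hmeas, ?_⟩
  let f : EuclideanSpace ℝ ι →ₗᵢ[ℝ] EuclideanSpace ℝ ι :=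
    { Matrix.toLpLin 2 2 U with
      norm_map' := fun x => by
        rw [← sq_eq_sq₀ (norm_nonneg _) (norm_nonneg _), EuclideanSpace.real_norm_sq_eq,
          EuclideanSpace.real_norm_sq_eq]
        simpa [dotProduct, sq] using dotProduct_mulVec_of_transpose_mul_self hU x.ofLp x.ofLp }
  let e := f.toLinearIsometryEquiv rfl
  have he := ProbabilityTheory.stdGaussian_map e
  rw [← map_pi_eq_stdGaussian, Measure.map_map (by fun_prop) (by fun_prop)] at he
  have := congrArg (Measure.map (WithLp.ofLp : EuclideanSpace ℝ ι → ι → ℝ)) he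
  rw [Measure.map_map (by fun_prop) (by fun_prop), Measure.map_map (by fun_prop) (by fun_prop)]
    at this
  exact this.trans Measure.map_id

theorem memLp_two_eval_pi_gaussianReal (i : ι) :
    MemLp (fun x : ι → ℝ => x i) 2 (Measure.pi fun _ : ι => gaussianReal 0 1) :=
  (memLp_id_gaussianReal (μ := 0) (v := 1) 2).comp_measurePreserving
    (measurePreserving_eval (fun _ : ι => gaussianReal 0 1) i)

theorem memLp_two_dotProduct_add_pi_gaussianReal (a : ι → ℝ) (c : ℝ) :
    MemLp (fun x : ι → ℝ => a ⬝ᵥ x + c) 2 (Measure.pi fun _ : ι => gaussianReal 0 1) :=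
  (memLp_finsetSum Finset.univ fun i _ =>
    (memLp_two_eval_pi_gaussianReal i).const_mul (a i)).add (memLp_const c)

theorem integral_mul_eval_pi_gaussianReal [DecidableEq ι] {l i : ι} (hil : i ≠ l) (g : ℝ → ℝ) :
    ∫ x : ι → ℝ, g (x l) * x i ∂(Measure.pi fun _ : ι => gaussianReal 0 1) = 0 := by
  let f : ι → ℝ → ℝ := fun k t => (if k = l then g t else 1) * (if k = i then t else 1)
  have hf : ∀ x : ι → ℝ, g (x l) * x i = ∏ k, f k (x k) := fun x => by
    simp only [f, Finset.prod_mul_distrib, Finset.prod_ite_eq', Finset.mem_univ, if_true]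
  simp_rw [hf]
  rw [integral_fintype_prod_eq_prod]
  refine Finset.prod_eq_zero (Finset.mem_univ i) ?_
  simp [f, hil]

theorem integral_mul_eval_mul_eval_pi_gaussianReal [DecidableEq ι] {l i : ι} (hil : i ≠ l)
    (g : ℝ → ℝ) (j : ι) :
    ∫ x : ι → ℝ, g (x l) * x j * x i ∂(Measure.pi fun _ : ι => gaussianReal 0 1) =
      if j = i then ∫ t, g t ∂gaussianReal 0 1 else 0 := by
  let f : ι → ℝ → ℝ := fun k t =>
    (if k = l then g t else 1) * (if k = j then t else 1) * (if k = i then t else 1)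
  have hf : ∀ x : ι → ℝ, g (x l) * x j * x i = ∏ k, f k (x k) := fun x => by
    simp only [f, Finset.prod_mul_distrib, Finset.prod_ite_eq', Finset.mem_univ, if_true]
  simp_rw [hf]
  rw [integral_fintype_prod_eq_prod]
  split_ifs with hji
  · subst hji
    have hsq : ∫ t : ℝ, t * t ∂gaussianReal 0 1 = 1 := by
      have h := variance_fun_id_gaussianReal (μ := 0) (v := 1)
      rw [variance_of_integral_eq_zero (by fun_prop) (by simp)] at h
      simpa [sq] using h
    have hfint : ∀ k, ∫ t, f k t ∂gaussianReal 0 1 =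
        if k = l then ∫ t, g t ∂gaussianReal 0 1 else 1 := fun k => by
      by_cases hk : k = l
      · subst hk; simp [f, hil.symm]
      · by_cases hkj : k = j
        · simp [f, hkj, hil, hsq]
        · simp [f, hk, hkj]
    simp [hfint]
  · refine Finset.prod_eq_zero (Finset.mem_univ i) ?_
    simp [f, hil, Ne.symm hji]

theorem integral_indicator_dotProduct_add_mul_eval_pi_gaussianReal [DecidableEq ι] {l i : ι}
    (hil : i ≠ l) {s : Set ℝ} (hs : MeasurableSet s) (a : ι → ℝ) (c : ℝ) :
    ∫ x : ι → ℝ, {x : ι → ℝ | x l ∈ s}.indicator (fun x => (a ⬝ᵥ x + c) * x i) x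
        ∂(Measure.pi fun _ : ι => gaussianReal 0 1) =
      a i * (gaussianReal 0 1).real s := by
  let g : ℝ → ℝ := s.indicator 1
  have hS : MeasurableSet {x : ι → ℝ | x l ∈ s} := measurable_pi_apply l hs
  have hfun : ∀ x : ι → ℝ, {x : ι → ℝ | x l ∈ s}.indicator (fun x => (a ⬝ᵥ x + c) * x i) x =
      (∑ j, a j * (g (x l) * x j * x i)) + c * (g (x l) * x i) := fun x => by
    by_cases h : x l ∈ s
    · simp [g, h, dotProduct, add_mul, Finset.sum_mul, mul_assoc]
    · simp [g, h]
  have hlin : Integrable (fun x : ι → ℝ => g (x l) * x i)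
      (Measure.pi fun _ : ι => gaussianReal 0 1) := by
    refine (((memLp_two_eval_pi_gaussianReal i).integrable (by norm_num)).indicator hS).congr
      (.of_forall fun x => ?_)
    by_cases h : x l ∈ s <;> simp [g, h]
  have hquad : ∀ j, Integrable (fun x : ι → ℝ => g (x l) * x j * x i)
      (Measure.pi fun _ : ι => gaussianReal 0 1) := fun j => by
    refine (((memLp_two_eval_pi_gaussianReal j).integrable_mul
      (memLp_two_eval_pi_gaussianReal i)).indicator hS).congr (.of_forall fun x => ?_)
    by_cases h : x l ∈ s <;> simp [g, h]
  simp_rw [hfun]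
  rw [integral_add (integrable_finsetSum _ fun j _ => (hquad j).const_mul _) (hlin.const_mul c),
    integral_finsetSum _ fun j _ => (hquad j).const_mul _]
  simp_rw [integral_const_mul, integral_mul_eval_pi_gaussianReal hil,
    integral_mul_eval_mul_eval_pi_gaussianReal hil]
  simp [g, integral_indicator_one hs]

end GaussianPi

theorem gaussianReal_real_Iic_eq_Phi (t : ℝ) : (gaussianReal 0 1).real (Set.Iic t) = Phi t := by
  rw [measureReal_def, gaussianReal_apply_eq_integral 0 one_ne_zero, ENNReal.toReal_ofReal
    (integral_nonneg fun x => gaussianPDFReal_nonneg 0 1 x), Phi]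
  congr 1
  ext x
  simp [gaussianPDFReal, phiPdf, div_eq_inv_mul]

theorem gaussianReal_real_setOf_pos {r : ℝ} (hr : 0 < r) (b : ℝ) :
    (gaussianReal 0 1).real {t | r * t + b > 0} = Phi (b / r) := by
  have : NullSingletonClass (gaussianReal 0 1) := nullSingletonClass_gaussianReal one_ne_zero
  have hset : {t : ℝ | r * t + b > 0} = (fun t => -t) ⁻¹' Set.Iio (b / r) := by
    ext t
    simp only [Set.mem_ofPred_eq, Set.mem_preimage, Set.mem_Iio, lt_div_iff₀ hr]
    constructor <;> intro h <;> linarith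
  rw [hset, measureReal_def, ← Measure.map_apply measurable_neg measurableSet_Iio,
    gaussianReal_map_neg, neg_zero, measure_congr Iio_ae_eq_Iic, ← measureReal_def,
    gaussianReal_real_Iic_eq_Phi]

theorem l2norm_pos {L : ℕ} {v : Fin L → ℝ} (hv : v ≠ 0) : 0 < l2norm v := by
  obtain ⟨i, hi⟩ := Function.ne_iff.mp hv
  exact Real.sqrt_pos.mpr (Finset.sum_pos' (fun j _ => sq_nonneg (v j))
    ⟨i, Finset.mem_univ i, sq_pos_of_ne_zero hi⟩)

/-- With `x ~ N(0, I_L)`, `U` orthogonal mapping `w ≠ 0` to `‖w‖ e_L`, `a = w − Γ`,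
`c = b − Δ`, and the ReLU-loss gradient `∂L/∂w = E[1_{wᵀx+b>0}(aᵀx+c)x]`:
for every coordinate `i ≠ L`, `[U ∂L/∂w]_i = ã_i Φ(b/‖w‖)` where `ã = U a`. -/
theorem relu_gradient_offlast (L : ℕ) (w Γ : Fin (L + 1) → ℝ) (hw : w ≠ 0) (b Δ : ℝ)
    (U : Matrix (Fin (L + 1)) (Fin (L + 1)) ℝ) (hU : Uᵀ * U = 1)
    (hUw : U.mulVec w = Pi.single (Fin.last L) (l2norm w))
    (grad : Fin (L + 1) → ℝ)
    (hgrad : ∀ i, grad i = ∫ x, Set.indicator {x | w ⬝ᵥ x + b > 0}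
      (fun x => ((w - Γ) ⬝ᵥ x + (b - Δ)) * x i) x ∂ stdGaussian (L + 1)) :
    ∀ i, i ≠ Fin.last L →
      U.mulVec grad i = U.mulVec (w - Γ) i * Phi (b / l2norm w) := by
  intro i hi
  have hfint : ∀ k, Integrable ({x | w ⬝ᵥ x + b > 0}.indicator
      fun x => ((w - Γ) ⬝ᵥ x + (b - Δ)) * x k) (_root_.stdGaussian (L + 1)) := fun k =>
    ((memLp_two_dotProduct_add_pi_gaussianReal _ _).integrable_mul
      (memLp_two_eval_pi_gaussianReal k)).indicator
      (measurableSet_lt measurable_const (by unfold dotProduct; fun_prop))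
  have hsum : U.mulVec grad i = ∫ x, {y : Fin (L + 1) → ℝ | y (Fin.last L) ∈
      {t | l2norm w * t + b > 0}}.indicator
        (fun y => (U.mulVec (w - Γ) ⬝ᵥ y + (b - Δ)) * y i) (U.mulVec x)
        ∂_root_.stdGaussian (L + 1) := by
    simp_rw [Matrix.mulVec, dotProduct, hgrad, ← integral_const_mul]
    rw [← integral_finsetSum _ fun k _ => (hfint k).const_mul _]
    refine integral_congr_ae (.of_forall fun x => ?_)
    have hwx : w ⬝ᵥ x = l2norm w * U.mulVec x (Fin.last L) := by
      rw [← dotProduct_mulVec_of_transpose_mul_self hU, hUw, single_dotProduct]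
    have hax := dotProduct_mulVec_of_transpose_mul_self hU (w - Γ) x
    change ∑ k, U i k * _ = Set.indicator _ (fun y => (U.mulVec (w - Γ) ⬝ᵥ y + (b - Δ)) * y i)
      (U.mulVec x)
    by_cases h : l2norm w * U.mulVec x (Fin.last L) + b > 0
    · rw [Set.indicator_of_mem (by exact h), hax]
      simp only [Set.indicator_of_mem (show x ∈ {x | w ⬝ᵥ x + b > 0} by simpa [hwx] using h)]
      simp only [Matrix.mulVec, dotProduct, Finset.mul_sum]
      exact Finset.sum_congr rfl fun k _ => by ring
    · rw [Set.indicator_of_notMem (by exact h)]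
      simp only [Set.indicator_of_notMem (show x ∉ {x | w ⬝ᵥ x + b > 0} by simpa [hwx] using h)]
      simp
  have hs : MeasurableSet {t : ℝ | l2norm w * t + b > 0} :=
    measurableSet_lt measurable_const (by fun_prop)
  have hU' := measurePreserving_mulVec_pi_gaussianReal hU
  rw [hsum, _root_.stdGaussian,
    ← integral_map (φ := U.mulVec) hU'.measurable.aemeasurable, hU'.map_eq,
    integral_indicator_dotProduct_add_mul_eval_pi_gaussianReal hi hs,
    gaussianReal_real_setOf_pos (l2norm_pos hw)]
  refine AEStronglyMeasurable.indicator (Measurable.aestronglyMeasurable ?_)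
    (measurable_pi_apply _ hs)
  unfold dotProduct
  fun_prop
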